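/- (Two-action policy-gradient update variance) Suppose the action set A has exactly two elements a and a', and suppose V̂ satisfies the Bellman equation for π. Then Var_π(Â^δHCA_N(a) − Â^δHCA_N(a') | S_0 = s) ≤ Var_π(Â^MC_N(a) − Â^MC_N(a') | S_0 = s). (Since with two actions the gradients of the action probabilities are negatives of each other, this is exactly the statement that each component of the policy-gradient update Σ_a Â(a)·∇_θ π(a|s) has variance no larger under the δHCA estimator than under the Monte-Carlo estimator.) -/

import Mathlib

open Finset

attribute [local instance] Classical.propDecidable

namespace HCA

/-- A trajectory of horizon `N`: the actions taken at steps `0, …, N-1` and the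
states reached after each step (the start state is fixed separately). -/
abbrev Traj (S A : Type*) (N : ℕ) : Type _ := (Fin N → A) × (Fin N → S)

variable {S A : Type*} [Fintype S] [Fintype A] [Nonempty S] [Nonempty A]

/-- The state `S_k` of a trajectory with start state `s`. -/
def st {N : ℕ} (s : S) (τ : Traj S A N) : ℕ → S
  | 0 => s
  | k + 1 => if h : k < N then τ.2 ⟨k, h⟩ else s

/-- The action `A_k` of a trajectory. -/
noncomputable def ac {N : ℕ} (τ : Traj S A N) (k : ℕ) : A :=
  if h : k < N then τ.1 ⟨k, h⟩ else Classical.arbitrary A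

/-- The probability `P_π(τ) = ∏_{k=0}^{N-1} π(A_k|S_k)·P(S_{k+1}|S_k,A_k)` of a
trajectory starting at `s`. -/
noncomputable def trajP (π : S → A → ℝ) (P : S → A → S → ℝ) (s : S) (N : ℕ)
    (τ : Traj S A N) : ℝ :=
  ∏ k : Fin N, π (st s τ k) (τ.1 k) * P (st s τ k) (τ.1 k) (st s τ (k + 1))

/-- Expectation `E_π[f | S_0 = s]` over trajectories. -/
noncomputable def expct (π : S → A → ℝ) (P : S → A → S → ℝ) (s : S) (N : ℕ)
    (f : Traj S A N → ℝ) : ℝ :=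
  ∑ τ : Traj S A N, trajP π P s N τ * f τ

/-- Variance `Var_π(f | S_0 = s)` over trajectories. -/
noncomputable def vr (π : S → A → ℝ) (P : S → A → S → ℝ) (s : S) (N : ℕ)
    (f : Traj S A N → ℝ) : ℝ :=
  expct π P s N (fun τ => (f τ - expct π P s N f) ^ 2)

/-- Covariance `cov_π(f, g | S_0 = s)` over trajectories. -/
noncomputable def cv (π : S → A → ℝ) (P : S → A → S → ℝ) (s : S) (N : ℕ)
    (f g : Traj S A N → ℝ) : ℝ :=
  expct π P s N (fun τ => (f τ - expct π P s N f) * (g τ - expct π P s N g))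

/-- Probability `P_π(E | S_0 = s)` of an event `E` on trajectories. -/
noncomputable def prE (π : S → A → ℝ) (P : S → A → S → ℝ) (s : S) (N : ℕ)
    (E : Traj S A N → Prop) : ℝ :=
  ∑ τ : Traj S A N, if E τ then trajP π P s N τ else 0

/-- The TD error `δ_k = r(S_k,A_k) + γ·V̂(S_{k+1}) − V̂(S_k)`. -/
noncomputable def td (r : S → A → ℝ) (γ : ℝ) (V : S → ℝ) (s : S) {N : ℕ}
    (τ : Traj S A N) (k : ℕ) : ℝ :=
  r (st s τ k) (ac τ k) + γ * V (st s τ (k + 1)) - V (st s τ k)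

/-- `p_k(s'|s,a) = P_π(S_k = s' | S_0 = s, A_0 = a)
  = P_π(A_0 = a, S_k = s' | S_0 = s) / π(a|s)`. -/
noncomputable def pkSA (π : S → A → ℝ) (P : S → A → S → ℝ) (s : S) (N k : ℕ)
    (a : A) (s' : S) : ℝ :=
  prE π P s N (fun τ => ac τ 0 = a ∧ st s τ k = s') / π s a

/-- `p_k(s'|s) = Σ_a π(a|s)·p_k(s'|s,a)`. -/
noncomputable def pkS (π : S → A → ℝ) (P : S → A → S → ℝ) (s : S) (N k : ℕ)
    (s' : S) : ℝ :=
  ∑ a : A, π s a * pkSA π P s N k a s'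

/-- The hindsight probability `p_k(a|s,s')`, defined as
`P_π(A_0 = a, S_k = s' | S_0 = s)/p_k(s'|s)` when `p_k(s'|s) > 0` and `0` otherwise. -/
noncomputable def pkA (π : S → A → ℝ) (P : S → A → S → ℝ) (s : S) (N k : ℕ)
    (a : A) (s' : S) : ℝ :=
  if 0 < pkS π P s N k s' then
    prE π P s N (fun τ => ac τ 0 = a ∧ st s τ k = s') / pkS π P s N k s'
  else 0

/-- The `N`-step Monte-Carlo advantage estimator
`Â^MC_N(a) = (1(A_0=a)/π(a|s))·Σ_{k=0}^{N−1} γ^k·δ_k`. -/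
noncomputable def mcEst (π : S → A → ℝ) (r : S → A → ℝ) (γ : ℝ) (V : S → ℝ)
    (s : S) (N : ℕ) (a : A) (τ : Traj S A N) : ℝ :=
  ((if ac τ 0 = a then (1 : ℝ) else 0) / π s a) * ∑ k ∈ range N, γ ^ k * td r γ V s τ k

/-- The `N`-step δHCA advantage estimator
`Â^δHCA_N(a) = (1(A_0=a)/π(a|s))·δ_0 + Σ_{k=1}^{N−1} γ^k·(p_k(a|s,S_k)/π(a|s))·δ_k`. -/
noncomputable def dhcaEst (π : S → A → ℝ) (P : S → A → S → ℝ) (r : S → A → ℝ)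
    (γ : ℝ) (V : S → ℝ) (s : S) (N : ℕ) (a : A) (τ : Traj S A N) : ℝ :=
  ((if ac τ 0 = a then (1 : ℝ) else 0) / π s a) * td r γ V s τ 0
    + ∑ k ∈ Ico 1 N, γ ^ k * (pkA π P s N k a (st s τ k) / π s a) * td r γ V s τ k

/-- `V` satisfies the Bellman equation for `π`:
`V(s₀) = Σ_a π(a|s₀)·(r(s₀,a) + γ·Σ_{s'} P(s'|s₀,a)·V(s'))` for every state `s₀`. -/
def IsBellman (π : S → A → ℝ) (P : S → A → S → ℝ) (r : S → A → ℝ) (γ : ℝ)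
    (V : S → ℝ) : Prop :=
  ∀ s₀ : S, V s₀ = ∑ a : A, π s₀ a * (r s₀ a + γ * ∑ s' : S, P s₀ a s' * V s')

/-- The conditional second moment `E_π[δ_k² | S_0 = s, S_k = s']`,
defined as `(Σ_{τ : S_k = s'} P_π(τ)·δ_k(τ)²)/p_k(s'|s)`. -/
noncomputable def sndMom (π : S → A → ℝ) (P : S → A → S → ℝ) (r : S → A → ℝ)
    (γ : ℝ) (V : S → ℝ) (s : S) (N k : ℕ) (s' : S) : ℝ :=
  (∑ τ : Traj S A N, if st s τ k = s' then trajP π P s N τ * (td r γ V s τ k) ^ 2 else 0)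
    / pkS π P s N k s'

section Helpers
variable {S A : Type*} [Fintype S] [Fintype A] [Nonempty S] [Nonempty A]

/-- Prepend a first action and a first reached state. -/
def cns {N : ℕ} (b : A) (x : S) (τ : Traj S A N) : Traj S A (N + 1) :=
  (Fin.cons b τ.1, Fin.cons x τ.2)

/-- `F` depends only on the first `k` actions and reached states. -/
def Dep {N : ℕ} (k : ℕ) (F : Traj S A N → ℝ) : Prop :=
  ∀ τ τ' : Traj S A N, (∀ i : Fin N, (i : ℕ) < k → τ.1 i = τ'.1 i ∧ τ.2 i = τ'.2 i) → F τ = F τ'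

lemma st_cns {N : ℕ} (s : S) (b : A) (x : S) (τ : Traj S A N) (k : ℕ) (hk : k ≤ N) :
    st s (cns b x τ) (k + 1) = st x τ k := by
  cases k with
  | zero => simp [st, cns]
  | succ k =>
    have h : k < N := hk
    have h' : k + 1 < N + 1 := by omega
    simp only [st, dif_pos h, dif_pos h']
    rfl

lemma ac_cns {N : ℕ} (b : A) (x : S) (τ : Traj S A N) (k : ℕ) (hk : k < N) :
    ac (cns b x τ) (k + 1) = ac τ k := by
  have h' : k + 1 < N + 1 := by omega
  simp only [ac, dif_pos hk, dif_pos h']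
  rfl

lemma ac_cns_zero {N : ℕ} (b : A) (x : S) (τ : Traj S A N) :
    ac (cns b x τ) 0 = b := by
  simp [ac, cns]

/-- The decomposition of trajectories. -/
def cnsEquiv (S A : Type*) (N : ℕ) : (A × S) × Traj S A N ≃ Traj S A (N + 1) where
  toFun p := cns p.1.1 p.1.2 p.2
  invFun τ := ((τ.1 0, τ.2 0), (Fin.tail τ.1, Fin.tail τ.2))
  left_inv p := by simp [cns]
  right_inv τ := by simp [cns]

lemma trajP_cns (π : S → A → ℝ) (P : S → A → S → ℝ) (s : S) (N : ℕ) (b : A) (x : S)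
    (τ : Traj S A N) :
    trajP π P s (N + 1) (cns b x τ) = π s b * P s b x * trajP π P x N τ := by
  unfold trajP
  rw [Fin.prod_univ_succ]
  refine congrArg₂ (· * ·) ?_ ?_
  · simp [st, cns]
  · apply Finset.prod_congr rfl
    intro i _
    have h1 : st s (cns b x τ) ((i.succ : Fin (N + 1)) : ℕ) = st x τ i := by
      rw [Fin.val_succ]; exact st_cns s b x τ i i.2.le
    have h2 : st s (cns b x τ) (((i.succ : Fin (N + 1)) : ℕ) + 1) = st x τ (i + 1) := by
      rw [Fin.val_succ]; exact st_cns s b x τ (i + 1) i.2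
    have h3 : (cns b x τ).1 i.succ = τ.1 i := by simp [cns]
    rw [h1, h2, h3]

lemma expct_succ (π : S → A → ℝ) (P : S → A → S → ℝ) (s : S) (N : ℕ)
    (f : Traj S A (N + 1) → ℝ) :
    expct π P s (N + 1) f
      = ∑ b : A, ∑ x : S, π s b * P s b x * expct π P x N (fun τ => f (cns b x τ)) := by
  unfold expct
  rw [← (cnsEquiv S A N).sum_comp, Fintype.sum_prod_type, Fintype.sum_prod_type]
  refine Finset.sum_congr rfl fun b _ => Finset.sum_congr rfl fun x _ => ?_
  rw [Finset.mul_sum]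
  refine Finset.sum_congr rfl fun τ _ => ?_
  change trajP π P s (N + 1) (cns b x τ) * f (cns b x τ) = _
  rw [trajP_cns]; ring

lemma expct_add (π : S → A → ℝ) (P : S → A → S → ℝ) (s : S) (N : ℕ)
    (f g : Traj S A N → ℝ) :
    expct π P s N (fun τ => f τ + g τ) = expct π P s N f + expct π P s N g := by
  simp [expct, mul_add, Finset.sum_add_distrib]

lemma expct_smul (π : S → A → ℝ) (P : S → A → S → ℝ) (s : S) (N : ℕ)
    (c : ℝ) (f : Traj S A N → ℝ) :
    expct π P s N (fun τ => c * f τ) = c * expct π P s N f := by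
  simp only [expct, Finset.mul_sum]
  exact Finset.sum_congr rfl fun _ _ => by ring

lemma expct_sum {ι : Type*} (π : S → A → ℝ) (P : S → A → S → ℝ) (s : S) (N : ℕ)
    (t : Finset ι) (f : ι → Traj S A N → ℝ) :
    expct π P s N (fun τ => ∑ i ∈ t, f i τ) = ∑ i ∈ t, expct π P s N (f i) := by
  simp only [expct, Finset.mul_sum]
  exact Finset.sum_comm

lemma expct_const (π : S → A → ℝ) (P : S → A → S → ℝ)
    (hπsum : ∀ s₀ : S, ∑ a : A, π s₀ a = 1)
    (hPsum : ∀ (s₀ : S) (a : A), ∑ s' : S, P s₀ a s' = 1) (c : ℝ) (N : ℕ) :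
    ∀ s : S, expct π P s N (fun _ => c) = c := by
  induction N with
  | zero => intro s; simp [expct, trajP]
  | succ N ih =>
    intro s
    rw [expct_succ]
    simp only [ih, mul_assoc, ← Finset.mul_sum, ← Finset.sum_mul, hPsum, hπsum, one_mul]

lemma trajP_nonneg (π : S → A → ℝ) (P : S → A → S → ℝ)
    (hπpos : ∀ s₀ a, 0 < π s₀ a) (hPnn : ∀ s₀ a s', 0 ≤ P s₀ a s') (s : S) (N : ℕ)
    (τ : Traj S A N) : 0 ≤ trajP π P s N τ :=
  Finset.prod_nonneg fun _ _ => mul_nonneg (hπpos _ _).le (hPnn _ _ _)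

/-- One-step conditional expectation. -/
noncomputable def bar (π : S → A → ℝ) (P : S → A → S → ℝ) (G : S → A → S → ℝ) (x : S) : ℝ :=
  ∑ b : A, ∑ y : S, π x b * P x b y * G x b y

lemma markov (π : S → A → ℝ) (P : S → A → S → ℝ)
    (hπsum : ∀ s₀ : S, ∑ a : A, π s₀ a = 1)
    (hPsum : ∀ (s₀ : S) (a : A), ∑ s' : S, P s₀ a s' = 1) (G : S → A → S → ℝ) (k : ℕ) :
    ∀ (N : ℕ) (s : S) (F : Traj S A N → ℝ), k < N → Dep k F →
      expct π P s N (fun τ => F τ * G (st s τ k) (ac τ k) (st s τ (k + 1)))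
        = expct π P s N (fun τ => F τ * bar π P G (st s τ k)) := by
  induction k with
  | zero =>
    intro N s F hk hF
    obtain ⟨N, rfl⟩ : ∃ M, N = M + 1 := ⟨N - 1, by omega⟩
    obtain ⟨τ₀⟩ : Nonempty (Traj S A (N + 1)) := inferInstance
    have hc : ∀ τ, F τ = F τ₀ := fun τ => hF τ τ₀ (by intro i hi; omega)
    simp only [hc, expct_smul]
    congr 1
    have e : ∀ τ : Traj S A (N + 1), st s τ 0 = s := fun _ => rfl
    simp only [e]
    rw [expct_const π P hπsum hPsum, expct_succ]
    unfold bar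
    refine Finset.sum_congr rfl fun b _ => Finset.sum_congr rfl fun x _ => ?_
    simp only [ac_cns_zero, st_cns s b x _ 0 (Nat.zero_le _)]
    have e : ∀ τ : Traj S A N, st x τ 0 = x := fun _ => rfl
    simp only [e]
    rw [expct_const π P hπsum hPsum]
  | succ k ih =>
    intro N s F hk hF
    obtain ⟨N, rfl⟩ : ∃ M, N = M + 1 := ⟨N - 1, by omega⟩
    have hk' : k < N := by omega
    rw [expct_succ, expct_succ]
    refine Finset.sum_congr rfl fun b _ => Finset.sum_congr rfl fun x _ => ?_
    congr 1
    simp only [st_cns s b x _ k hk'.le, st_cns s b x _ (k + 1) hk', ac_cns b x _ k hk']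
    apply ih N x (fun τ => F (cns b x τ)) hk'
    intro τ τ' h
    apply hF
    intro i hi
    refine Fin.cases ?_ (fun j hj => ?_) i hi
    · intro _; simp [cns]
    · simpa [cns] using h j (by simpa using hj)

lemma Dep.mono {N : ℕ} {j k : ℕ} (h : j ≤ k) {F : Traj S A N → ℝ} (hF : Dep j F) : Dep k F :=
  fun τ τ' H => hF τ τ' fun i hi => H i (by omega)

lemma Dep.mul {N : ℕ} {k : ℕ} {F G : Traj S A N → ℝ} (hF : Dep k F) (hG : Dep k G) :
    Dep k (fun τ => F τ * G τ) :=
  fun τ τ' H => by simp only [hF τ τ' H, hG τ τ' H]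

lemma Dep.sum {N : ℕ} {k : ℕ} {ι : Type*} (t : Finset ι) {F : ι → Traj S A N → ℝ}
    (hF : ∀ i ∈ t, Dep k (F i)) :
    Dep k (fun τ => ∑ i ∈ t, F i τ) :=
  fun τ τ' H => Finset.sum_congr rfl fun i hi => hF i hi τ τ' H

lemma st_congr {N : ℕ} (s : S) (k : ℕ) (τ τ' : Traj S A N)
    (H : ∀ i : Fin N, (i : ℕ) < k → τ.1 i = τ'.1 i ∧ τ.2 i = τ'.2 i) :
    st s τ k = st s τ' k := by
  cases k with
  | zero => rfl
  | succ k =>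
    simp only [st]
    split_ifs with h
    · exact (H ⟨k, h⟩ (Nat.lt_succ_self k)).2
    · rfl

lemma ac_congr {N : ℕ} (k : ℕ) (τ τ' : Traj S A N)
    (H : ∀ i : Fin N, (i : ℕ) < k + 1 → τ.1 i = τ'.1 i ∧ τ.2 i = τ'.2 i) :
    ac τ k = ac τ' k := by
  unfold ac
  split_ifs with h
  · exact (H ⟨k, h⟩ (Nat.lt_succ_self k)).1
  · rfl

lemma dep_td (r : S → A → ℝ) (γ : ℝ) (V : S → ℝ) (s : S) {N : ℕ} (k : ℕ) :
    Dep (k + 1) (fun τ : Traj S A N => td r γ V s τ k) := by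
  intro τ τ' H
  simp only [td]
  rw [ac_congr k τ τ' H, st_congr s (k + 1) τ τ' H,
    st_congr s k τ τ' fun i hi => H i (by omega)]

/-- Martingale-difference property of the TD errors. -/
lemma td_orth (π : S → A → ℝ) (P : S → A → S → ℝ) (r : S → A → ℝ) (γ : ℝ)
    (hπsum : ∀ s₀ : S, ∑ a : A, π s₀ a = 1)
    (hPsum : ∀ (s₀ : S) (a : A), ∑ s' : S, P s₀ a s' = 1)
    (V : S → ℝ) (hV : IsBellman π P r γ V) (s : S) (N k : ℕ) (hk : k < N)
    (F : Traj S A N → ℝ) (hF : Dep k F) :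
    expct π P s N (fun τ => F τ * td r γ V s τ k) = 0 := by
  have h := markov π P hπsum hPsum (fun x b y => r x b + γ * V y - V x) k N s F hk hF
  have hb : ∀ x, bar π P (fun x b y => r x b + γ * V y - V x) x = 0 := by
    intro x
    unfold bar
    have e : ∀ b, ∑ y : S, π x b * P x b y * (r x b + γ * V y - V x)
        = π x b * (r x b + γ * ∑ y : S, P x b y * V y) - π x b * V x := by
      intro b
      have : ∀ y, π x b * P x b y * (r x b + γ * V y - V x)
          = P x b y * (π x b * (r x b - V x)) + π x b * γ * (P x b y * V y) := by
        intro y; ring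
      simp only [this, Finset.sum_add_distrib, ← Finset.sum_mul, ← Finset.mul_sum, hPsum]
      ring
    simp only [e, Finset.sum_sub_distrib, ← Finset.sum_mul, hπsum, ← hV x]
    ring
  simp only [hb, mul_zero] at h
  rw [expct_const π P hπsum hPsum] at h
  exact h

lemma vr_eq (π : S → A → ℝ) (P : S → A → S → ℝ)
    (hπsum : ∀ s₀ : S, ∑ a : A, π s₀ a = 1)
    (hPsum : ∀ (s₀ : S) (a : A), ∑ s' : S, P s₀ a s' = 1) (s : S) (N : ℕ)
    (f : Traj S A N → ℝ) :
    vr π P s N f = expct π P s N (fun τ => f τ ^ 2) - expct π P s N f ^ 2 := by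
  unfold vr
  set m := expct π P s N f with hm
  have : (fun τ => (f τ - m) ^ 2) = fun τ => (f τ ^ 2 + (-2 * m) * f τ) + m ^ 2 := by
    funext τ; ring
  rw [this, expct_add, expct_add, expct_smul, expct_const π P hπsum hPsum, ← hm]
  ring

/-- Variance of a weighted sum of TD errors. -/
lemma vr_weighted (π : S → A → ℝ) (P : S → A → S → ℝ) (r : S → A → ℝ) (γ : ℝ)
    (hπsum : ∀ s₀ : S, ∑ a : A, π s₀ a = 1)
    (hPsum : ∀ (s₀ : S) (a : A), ∑ s' : S, P s₀ a s' = 1)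
    (V : S → ℝ) (hV : IsBellman π P r γ V) (s : S) (N : ℕ) (hN : 1 ≤ N)
    (u : ℕ → Traj S A N → ℝ) (hu0 : Dep 1 (u 0)) (hu : ∀ k, 1 ≤ k → Dep k (u k)) :
    vr π P s N (fun τ => ∑ k ∈ range N, u k τ * td r γ V s τ k)
      = ∑ k ∈ range N, expct π P s N (fun τ => (u k τ * td r γ V s τ k) ^ 2)
        - expct π P s N (fun τ => u 0 τ * td r γ V s τ 0) ^ 2 := by
  have hX : ∀ k, Dep (k + 1) (fun τ => u k τ * td r γ V s τ k) := by
    intro k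
    refine Dep.mul ?_ (dep_td r γ V s k)
    rcases Nat.eq_zero_or_pos k with rfl | h
    · exact hu0
    · exact (hu k h).mono (Nat.le_succ k)
  have key : ∀ n, 1 ≤ n → n ≤ N →
      expct π P s N (fun τ => ∑ k ∈ range n, u k τ * td r γ V s τ k)
        = expct π P s N (fun τ => u 0 τ * td r γ V s τ 0) ∧
      expct π P s N (fun τ => (∑ k ∈ range n, u k τ * td r γ V s τ k) ^ 2)
        = ∑ k ∈ range n, expct π P s N (fun τ => (u k τ * td r γ V s τ k) ^ 2) := by
    intro n hn
    induction n, hn using Nat.le_induction with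
    | base => intro _; simp
    | succ n hn ih =>
      intro hnN
      obtain ⟨ih1, ih2⟩ := ih (by omega)
      constructor
      · simp only [Finset.sum_range_succ _ n]
        rw [expct_add, ih1, td_orth π P r γ hπsum hPsum V hV s N n (by omega) (u n) (hu n hn),
          add_zero]
      · have hY : Dep n (fun τ => ∑ k ∈ range n, u k τ * td r γ V s τ k) :=
          Dep.sum _ fun i hi => (hX i).mono (Finset.mem_range.1 hi)
        have e : (fun τ => (∑ k ∈ range (n + 1), u k τ * td r γ V s τ k) ^ 2)
          = fun τ => ((∑ k ∈ range n, u k τ * td r γ V s τ k) ^ 2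
            + 2 * (((∑ k ∈ range n, u k τ * td r γ V s τ k) * u n τ) * td r γ V s τ n))
            + (u n τ * td r γ V s τ n) ^ 2 := by
          funext τ; rw [Finset.sum_range_succ]; ring
        rw [e, expct_add, expct_add, expct_smul, ih2, Finset.sum_range_succ _ n,
          td_orth π P r γ hπsum hPsum V hV s N n (by omega) _ (hY.mul (hu n hn))]
        ring
  obtain ⟨h1, h2⟩ := key N hN le_rfl
  rw [vr_eq π P hπsum hPsum, h1, h2]

lemma prE_nonneg (π : S → A → ℝ) (P : S → A → S → ℝ)
    (hπpos : ∀ s₀ a, 0 < π s₀ a) (hPnn : ∀ s₀ a s', 0 ≤ P s₀ a s') (s : S) (N : ℕ)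
    (E : Traj S A N → Prop) : 0 ≤ prE π P s N E := by
  refine Finset.sum_nonneg fun τ _ => ?_
  split_ifs
  · exact trajP_nonneg π P hπpos hPnn s N τ
  · exact le_rfl

lemma pkS_eq (π : S → A → ℝ) (P : S → A → S → ℝ)
    (hπpos : ∀ s₀ a, 0 < π s₀ a) (s : S) (N k : ℕ) (x : S) :
    pkS π P s N k x = ∑ b : A, prE π P s N (fun τ => ac τ 0 = b ∧ st s τ k = x) := by
  unfold pkS pkSA
  exact Finset.sum_congr rfl fun b _ => mul_div_cancel₀ _ (hπpos s b).ne'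

lemma pkA_mul (π : S → A → ℝ) (P : S → A → S → ℝ)
    (hπpos : ∀ s₀ a, 0 < π s₀ a) (hPnn : ∀ s₀ a s', 0 ≤ P s₀ a s') (s : S) (N k : ℕ)
    (b : A) (x : S) :
    pkA π P s N k b x * pkS π P s N k x = prE π P s N (fun τ => ac τ 0 = b ∧ st s τ k = x) := by
  unfold pkA
  split_ifs with h
  · exact div_mul_cancel₀ _ h.ne'
  · rw [zero_mul]
    apply le_antisymm (prE_nonneg π P hπpos hPnn s N _)
    refine le_trans ?_ (not_lt.1 h)
    rw [pkS_eq π P hπpos]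
    exact Finset.single_le_sum
      (f := fun b => prE π P s N (fun τ => ac τ 0 = b ∧ st s τ k = x))
      (fun i _ => prE_nonneg π P hπpos hPnn s N _) (Finset.mem_univ b)

lemma expct_split (π : S → A → ℝ) (P : S → A → S → ℝ) (s : S) (N k : ℕ)
    (f : A → S → ℝ) :
    expct π P s N (fun τ => f (ac τ 0) (st s τ k))
      = ∑ x : S, ∑ b : A, prE π P s N (fun τ => ac τ 0 = b ∧ st s τ k = x) * f b x := by
  unfold expct prE
  simp only [Finset.sum_mul]
  rw [Finset.sum_congr rfl (fun x _ => Finset.sum_comm)]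
  rw [Finset.sum_comm]
  refine Finset.sum_congr rfl fun τ _ => ?_
  rw [Finset.sum_eq_single (st s τ k), Finset.sum_eq_single (ac τ 0)]
  · simp
  · intro b _ hb; simp [hb.symm]
  · simp
  · intro x _ hx; simp [hx.symm]
  · simp

/-- `c(S_k) = E[w(A_0) | S_k]`. -/
lemma cond_eq (π : S → A → ℝ) (P : S → A → S → ℝ)
    (hπpos : ∀ s₀ a, 0 < π s₀ a) (hPnn : ∀ s₀ a s', 0 ≤ P s₀ a s') (s : S) (N k : ℕ)
    (w : A → ℝ) (h : S → ℝ) :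
    expct π P s N (fun τ => w (ac τ 0) * h (st s τ k))
      = expct π P s N (fun τ => (∑ b : A, w b * pkA π P s N k b (st s τ k)) * h (st s τ k)) := by
  rw [expct_split π P s N k (fun b x => w b * h x),
    expct_split π P s N k (fun _ x => (∑ b : A, w b * pkA π P s N k b x) * h x)]
  refine Finset.sum_congr rfl fun x _ => ?_
  rw [← Finset.sum_mul, ← pkS_eq π P hπpos, Finset.sum_mul, Finset.mul_sum]
  refine Finset.sum_congr rfl fun b _ => ?_
  rw [← pkA_mul π P hπpos hPnn]
  ring

lemma jensen (π : S → A → ℝ) (P : S → A → S → ℝ)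
    (hπpos : ∀ s₀ a, 0 < π s₀ a) (hPnn : ∀ s₀ a s', 0 ≤ P s₀ a s') (s : S) (N k : ℕ)
    (w : A → ℝ) (g : S → ℝ) (hg : ∀ x, 0 ≤ g x) :
    expct π P s N (fun τ => (∑ b : A, w b * pkA π P s N k b (st s τ k)) ^ 2 * g (st s τ k))
      ≤ expct π P s N (fun τ => w (ac τ 0) ^ 2 * g (st s τ k)) := by
  set c : S → ℝ := fun x => ∑ b : A, w b * pkA π P s N k b x with hc
  have h0 : 0 ≤ expct π P s N (fun τ => (w (ac τ 0) - c (st s τ k)) ^ 2 * g (st s τ k)) :=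
    Finset.sum_nonneg fun τ _ => mul_nonneg (trajP_nonneg π P hπpos hPnn s N τ)
      (mul_nonneg (sq_nonneg _) (hg _))
  have e : (fun τ : Traj S A N => (w (ac τ 0) - c (st s τ k)) ^ 2 * g (st s τ k))
      = fun τ => (w (ac τ 0) ^ 2 * g (st s τ k)
        + (-2) * (w (ac τ 0) * (c (st s τ k) * g (st s τ k))))
        + c (st s τ k) ^ 2 * g (st s τ k) := by
    funext τ; ring
  have h1 := cond_eq π P hπpos hPnn s N k w (fun x => c x * g x)
  have e2 : (fun τ : Traj S A N =>
      (∑ b : A, w b * pkA π P s N k b (st s τ k)) * (c (st s τ k) * g (st s τ k)))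
      = fun τ => c (st s τ k) ^ 2 * g (st s τ k) := by
    funext τ
    change c (st s τ k) * _ = _
    ring
  rw [e, expct_add, expct_add, expct_smul, h1, e2] at h0
  change expct π P s N (fun τ => c (st s τ k) ^ 2 * g (st s τ k)) ≤ _
  linarith

end Helpers

theorem stmt_14 {S A : Type*} [Fintype S] [Fintype A] [Nonempty S] [Nonempty A]
    (π : S → A → ℝ) (P : S → A → S → ℝ) (r : S → A → ℝ) (γ : ℝ)
    (N : ℕ) (s : S)
    (hπpos : ∀ s₀ a, 0 < π s₀ a) (hπsum : ∀ s₀ : S, ∑ a : A, π s₀ a = 1)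
    (hPnn : ∀ s₀ a s', 0 ≤ P s₀ a s') (hPsum : ∀ (s₀ : S) (a : A), ∑ s' : S, P s₀ a s' = 1)
    (hγ0 : 0 ≤ γ) (hγ1 : γ ≤ 1) (hN : 1 ≤ N)
    (V : S → ℝ) (hV : IsBellman π P r γ V)
    (a a' : A) (hne : a ≠ a') (htwo : ∀ b : A, b = a ∨ b = a') :
    vr π P s N (fun τ => dhcaEst π P r γ V s N a τ - dhcaEst π P r γ V s N a' τ)
      ≤ vr π P s N (fun τ => mcEst π r γ V s N a τ - mcEst π r γ V s N a' τ) := by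
  set w : A → ℝ := fun b =>
    (if b = a then (1 : ℝ) else 0) / π s a - (if b = a' then (1 : ℝ) else 0) / π s a' with hw
  have hwsum : ∀ q : A → ℝ, ∑ b : A, w b * q b = q a / π s a - q a' / π s a' := by
    intro q
    simp only [hw, sub_mul, Finset.sum_sub_distrib, div_mul_eq_mul_div, ite_mul, one_mul,
      zero_mul, ← Finset.sum_div, Finset.sum_ite_eq', Finset.mem_univ, if_true]
  set c : ℕ → S → ℝ := fun k x => ∑ b : A, w b * pkA π P s N k b x with hc
  set u1 : ℕ → Traj S A N → ℝ := fun k τ =>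
    γ ^ k * (if k = 0 then w (ac τ 0) else c k (st s τ k)) with hu1
  set u2 : ℕ → Traj S A N → ℝ := fun k τ => γ ^ k * w (ac τ 0) with hu2
  have hw1 : Dep 1 (fun τ : Traj S A N => w (ac τ 0)) := fun τ τ' H => by
    simp only [ac_congr 0 τ τ' H]
  have e1 : (fun τ => dhcaEst π P r γ V s N a τ - dhcaEst π P r γ V s N a' τ)
      = fun τ => ∑ k ∈ range N, u1 k τ * td r γ V s τ k := by
    funext τ
    rw [Finset.range_eq_Ico, Finset.sum_eq_sum_Ico_succ_bot (by omega)]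
    unfold dhcaEst
    rw [add_sub_add_comm, ← Finset.sum_sub_distrib]
    congr 1
    · simp only [hu1, hw, if_true, pow_zero]; ring
    · refine Finset.sum_congr rfl fun k hk => ?_
      have hk0 : k ≠ 0 := by have := (Finset.mem_Ico.1 hk).1; omega
      simp only [hu1, if_neg hk0, hc, hwsum]
      ring
  have e2 : (fun τ => mcEst π r γ V s N a τ - mcEst π r γ V s N a' τ)
      = fun τ => ∑ k ∈ range N, u2 k τ * td r γ V s τ k := by
    funext τ
    unfold mcEst
    rw [← sub_mul, Finset.mul_sum]
    refine Finset.sum_congr rfl fun k _ => ?_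
    simp only [hu2, hw]
    ring
  have hd2 : ∀ k, Dep 1 (u2 k) := fun k τ τ' H => by
    simp only [hu2, ac_congr 0 τ τ' H]
  have h00 : u1 0 = u2 0 := by
    funext τ; simp only [hu1, hu2, if_true]
  rw [e1, e2, vr_weighted π P r γ hπsum hPsum V hV s N hN u1 (h00 ▸ hd2 0) ?_,
    vr_weighted π P r γ hπsum hPsum V hV s N hN u2 (hd2 0) (fun k hk => (hd2 k).mono hk), h00]
  · apply sub_le_sub_right
    refine Finset.sum_le_sum fun k hk => ?_
    rcases Nat.eq_zero_or_pos k with rfl | hk0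
    · rw [h00]
    have hkN := Finset.mem_range.1 hk
    set G : S → A → S → ℝ := fun x b y => (r x b + γ * V y - V x) ^ 2 with hG
    have hb : ∀ x, 0 ≤ bar π P G x := fun x =>
      Finset.sum_nonneg fun b _ => Finset.sum_nonneg fun y _ =>
        mul_nonneg (mul_nonneg (hπpos _ _).le (hPnn _ _ _)) (sq_nonneg _)
    have hdc : Dep k (fun τ : Traj S A N => c k (st s τ k) ^ 2) := fun τ τ' H => by
      simp only [st_congr s k τ τ' H]
    have hdw : Dep k (fun τ : Traj S A N => w (ac τ 0) ^ 2) := fun τ τ' H => by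
      simp only [ac_congr 0 τ τ' fun i hi => H i (by omega)]
    have f1 : (fun τ => (u1 k τ * td r γ V s τ k) ^ 2) = fun τ => (γ ^ k) ^ 2 *
        (c k (st s τ k) ^ 2 * G (st s τ k) (ac τ k) (st s τ (k + 1))) := by
      funext τ; simp only [hu1, if_neg hk0.ne', hG, td]; ring
    have f2 : (fun τ => (u2 k τ * td r γ V s τ k) ^ 2) = fun τ => (γ ^ k) ^ 2 *
        (w (ac τ 0) ^ 2 * G (st s τ k) (ac τ k) (st s τ (k + 1))) := by
      funext τ; simp only [hu2, hG, td]; ring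
    rw [f1, f2, expct_smul, expct_smul, markov π P hπsum hPsum G k N s _ hkN hdc,
      markov π P hπsum hPsum G k N s _ hkN hdw]
    exact mul_le_mul_of_nonneg_left (jensen π P hπpos hPnn s N k w _ hb) (sq_nonneg _)
  · intro k hk τ τ' H
    have hk0 : k ≠ 0 := by omega
    simp only [hu1, if_neg hk0, st_congr s k τ τ' H]

end HCA
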